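/- arXiv:2009.14170 — 3 statements merged into one kernel-verified Lean document; each statement's English description precedes it below -/
import Mathlib

section
/- Let k be a field and let C be a k-linear abelian category in which every object has finite length and in which Ext¹_C(Y, X) is a finite-dimensional k-vector space for all objects X, Y. Let F : C ≌ C be a k-linear self-equivalence of C. Then for every object M of C the following are equivalent: (i) for every simple object S of C that is a subquotient of M there exists an integer n > 0 such that Fⁿ(S) ≅ S; (ii) there exist an object N of C with F(N) ≅ N and a monomorphism M ↪ N. -/
open CategoryTheory Limits CategoryTheory.Abelian

universe w v u t

namespace CategoryTheory.Abelian.Ext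

variable {C : Type u} [Category.{v} C] [Abelian C] [HasExt.{w} C]
variable {k : Type t} [Field k] [Linear k C]

lemma mk₀_add' {X Y : C} (f g : X ⟶ Y) : mk₀ (f + g) = mk₀ f + mk₀ g := by
  letI := HasDerivedCategory.standard C
  apply Ext.ext
  simp only [mk₀_hom, Functor.map_add, add_hom]
  simp [ShiftedHom.mk₀, Preadditive.add_comp]

/-- The canonical scalar multiplication on `Ext`-groups of a `k`-linear abelian category:
`c • ε` is the push-forward of `ε` along `c • 𝟙`. -/
noncomputable instance extSMul {X Y : C} {n : ℕ} : SMul k (Ext X Y n) :=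
  ⟨fun c ε => ε.comp (mk₀ (c • 𝟙 Y)) (add_zero n)⟩

lemma smul_def {X Y : C} {n : ℕ} (c : k) (ε : Ext X Y n) :
    c • ε = ε.comp (mk₀ (c • 𝟙 Y)) (add_zero n) := rfl

/-- The canonical `k`-vector space structure on `Ext`-groups of a `k`-linear
abelian category. -/
noncomputable instance extModule {X Y : C} {n : ℕ} : Module k (Ext X Y n) where
  one_smul ε := by rw [smul_def, one_smul, comp_mk₀_id]
  mul_smul a b ε := by
    rw [smul_def, smul_def, smul_def, comp_assoc_of_third_deg_zero, mk₀_comp_mk₀]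
    congr 2
    rw [Linear.smul_comp, Linear.comp_smul, Category.comp_id, smul_smul, mul_comm]
  smul_zero a := by rw [smul_def, zero_comp]
  smul_add a ε₁ ε₂ := by rw [smul_def, smul_def, smul_def, add_comp]
  add_smul a b ε := by
    rw [smul_def, smul_def, smul_def, add_smul, mk₀_add', comp_add]
  zero_smul ε := by rw [smul_def, zero_smul, mk₀_zero, comp_zero]

end CategoryTheory.Abelian.Ext

variable {C : Type u} [Category.{v} C] [Abelian C]

/-- The `n`-fold iterate of an endofunctor. -/
def funcPow (F : C ⥤ C) : ℕ → C ⥤ C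
  | 0 => 𝟭 C
  | n + 1 => funcPow F n ⋙ F

/-- `S` is a subquotient of `M` if there are an object `X`, a monomorphism `X ↪ M` and an
epimorphism `X ↠ S`. -/
def IsSubquotient (S M : C) : Prop :=
  ∃ (X : C) (f : X ⟶ M) (g : X ⟶ S), Mono f ∧ Epi g

/-- An object `M` has finite length if there is a finite chain of monomorphisms
`0 = X₀ ↪ X₁ ↪ ⋯ ↪ X_m = M` all of whose successive quotients are simple. -/
def HasFiniteLength (M : C) : Prop :=
  ∃ (m : ℕ) (X : Fin (m + 1) → C) (f : ∀ i : Fin m, X i.castSucc ⟶ X i.succ),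
    IsZero (X 0) ∧ (∀ i : Fin m, Mono (f i) ∧ Simple (cokernel (f i))) ∧
      Nonempty (X (Fin.last m) ≅ M)

section FiniteLength

attribute [local instance] Abelian.hasFiniteBiproducts

/-- Induction principle for objects of finite length: a property holding for zero objects and
stable under isomorphisms and under extensions by simple quotients holds for all of them. -/
@[elab_as_elim]
lemma HasFiniteLength.induction {P : C → Prop} (zero : ∀ X : C, IsZero X → P X)
    (iso : ∀ {X Y : C}, (X ≅ Y) → P X → P Y)
    (step : ∀ {X Y : C} (f : X ⟶ Y), Mono f → Simple (cokernel f) → P X → P Y)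
    {M : C} (hM : HasFiniteLength M) : P M := by
  obtain ⟨m, X, f, h₀, hf, ⟨e⟩⟩ := hM
  have hP (i : Fin (m + 1)) : P (X i) := by
    induction i using Fin.induction with
    | zero => exact zero _ h₀
    | succ i ih => exact step (f i) (hf i).1 (hf i).2 ih
  exact iso e (hP _)

lemma IsSubquotient.of_mono {D : Type u} [Category.{v} D] {S M N : D}
    (h : IsSubquotient S M) (f : M ⟶ N) [Mono f] : IsSubquotient S N := by
  obtain ⟨X, i, p, hi, hp⟩ := h
  exact ⟨X, i ≫ f, p, mono_comp _ _, hp⟩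

lemma IsSubquotient.map_equivalence {S M : C} (h : IsSubquotient S M) (F : C ≌ C) :
    IsSubquotient (F.functor.obj S) (F.functor.obj M) := by
  obtain ⟨X, i, p, hi, hp⟩ := h
  exact ⟨F.functor.obj X, F.functor.map i, F.functor.map p, inferInstance, inferInstance⟩

lemma isSubquotient_cokernel {X Y : C} (f : X ⟶ Y) : IsSubquotient (cokernel f) Y :=
  ⟨Y, 𝟙 Y, cokernel.π f, inferInstance, inferInstance⟩

/-- A simple subquotient of an extension of `cokernel f` by `X` is a subquotient of `X` or of
`cokernel f`. -/
lemma IsSubquotient.of_extension {S X Y : C} [Simple S] (f : X ⟶ Y) [Mono f]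
    (h : IsSubquotient S Y) : IsSubquotient S X ∨ IsSubquotient S (cokernel f) := by
  obtain ⟨Z, i, p, _, _⟩ := h
  by_cases hz : pullback.snd f i ≫ p = 0
  · right
    have hker : kernel.ι (i ≫ cokernel.π f) ≫ p = 0 := by
      have hex : (ShortComplex.mk f (cokernel.π f) (by simp)).Exact :=
        ShortComplex.exact_of_g_is_cokernel _ (cokernelIsCokernel f)
      let l : kernel (i ≫ cokernel.π f) ⟶ X :=
        hex.lift (kernel.ι (i ≫ cokernel.π f) ≫ i) (by simp)
      have hl : l ≫ f = kernel.ι (i ≫ cokernel.π f) ≫ i := hex.lift_f _ _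
      have : kernel.ι (i ≫ cokernel.π f) = pullback.lift l _ hl ≫ pullback.snd f i :=
        (pullback.lift_snd _ _ _).symm
      rw [this, Category.assoc, hz, comp_zero]
    refine ⟨Abelian.coimage (i ≫ cokernel.π f), Abelian.factorThruCoimage _,
      cokernel.desc _ p hker, inferInstance, ?_⟩
    have hp : cokernel.π _ ≫ cokernel.desc (kernel.ι (i ≫ cokernel.π f)) p hker = p := by simp
    exact epi_of_epi_fac hp
  · left
    exact ⟨_, pullback.fst f i, _, inferInstance, epi_of_nonzero_to_simple hz⟩

lemma IsSubquotient.nonempty_iso {S T : C} [Simple S] [Simple T] (h : IsSubquotient S T) :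
    Nonempty (S ≅ T) := by
  obtain ⟨X, i, p, _, _⟩ := h
  have hi : i ≠ 0 := by
    rintro rfl
    have hX : IsZero X := IsZero.of_mono_eq_zero (0 : X ⟶ T) rfl
    exact Simple.not_isZero S (IsZero.of_epi_eq_zero p (hX.eq_of_src _ _))
  have := isIso_of_mono_of_nonzero hi
  have hp : inv i ≫ p ≠ 0 := by
    intro h0
    exact Simple.not_isZero S (IsZero.of_epi_eq_zero _ h0)
  have := isIso_of_epi_of_nonzero hp
  exact ⟨(asIso (inv i ≫ p)).symm⟩

/-- An object of finite length has only finitely many simple subquotients up to isomorphism. -/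
lemma HasFiniteLength.exists_list_simple_subquotients {M : C} (hM : HasFiniteLength M) :
    ∃ l : List C, ∀ S : C, Simple S → IsSubquotient S M → ∃ T ∈ l, Nonempty (S ≅ T) := by
  refine hM.induction (fun X hX => ?_) (fun e h => ?_) (fun f _ _ h => ?_)
  · refine ⟨[], fun S hS ⟨Y, i, p, _, _⟩ => ?_⟩
    have hY : IsZero Y := IsZero.of_mono_eq_zero i (hX.eq_of_tgt _ _)
    exact (Simple.not_isZero S (IsZero.of_epi_eq_zero p (hY.eq_of_src _ _))).elim
  · obtain ⟨l, hl⟩ := h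
    exact ⟨l, fun S hS hSM => hl S hS (hSM.of_mono e.inv)⟩
  · obtain ⟨l, hl⟩ := h
    refine ⟨cokernel f :: l, fun S hS hSM => ?_⟩
    rcases hSM.of_extension f with h | h
    · obtain ⟨T, hT, e⟩ := hl S hS h
      exact ⟨T, List.mem_cons_of_mem _ hT, e⟩
    · exact ⟨_, List.mem_cons_self, h.nonempty_iso⟩

lemma nonempty_iso_funcPow_of_add {D : Type u} [Category.{v} D] (F : D ≌ D) (S : D) (a d : ℕ)
    (h : Nonempty ((funcPow F.functor (a + d)).obj S ≅ (funcPow F.functor a).obj S)) :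
    Nonempty ((funcPow F.functor d).obj S ≅ S) := by
  induction a with
  | zero => rwa [zero_add] at h
  | succ a ih =>
    rw [Nat.succ_add] at h
    exact ih (h.map F.functor.preimageIso)

/-- Simple subquotients of an `F`-invariant object of finite length are `F`-periodic. -/
lemma exists_funcPow_iso_of_isSubquotient_invariant (F : C ≌ C) {N : C}
    (hN : HasFiniteLength N) (e : F.functor.obj N ≅ N) (S : C) (hS : Simple S)
    (hSN : IsSubquotient S N) : ∃ n : ℕ, 0 < n ∧ Nonempty ((funcPow F.functor n).obj S ≅ S) := by
  have hpow (n : ℕ) : Simple ((funcPow F.functor n).obj S) ∧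
      IsSubquotient ((funcPow F.functor n).obj S) N := by
    induction n with
    | zero => exact ⟨hS, hSN⟩
    | succ n ih =>
      have := ih.1
      exact ⟨simple_obj F.functor _, (ih.2.map_equivalence F).of_mono e.hom⟩
  obtain ⟨l, hl⟩ := hN.exists_list_simple_subquotients
  choose T hT eT using fun n => hl _ (hpow n).1 (hpow n).2
  obtain ⟨a, b, hab, h⟩ : ∃ a b : ℕ, a < b ∧ T a = T b := by
    have := (List.finite_toSet l).to_subtype
    obtain ⟨a, b, hab, h⟩ := Finite.exists_ne_map_eq_of_infinite
      (fun n => (⟨T n, hT n⟩ : {x // x ∈ {x | x ∈ l}}))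
    rw [Subtype.mk.injEq] at h
    rcases hab.lt_or_gt with hab | hab
    · exact ⟨a, b, hab, h⟩
    · exact ⟨b, a, hab, h.symm⟩
  refine ⟨b - a, Nat.sub_pos_of_lt hab, nonempty_iso_funcPow_of_add F S a _ ?_⟩
  rw [Nat.add_sub_cancel' hab.le]
  exact ⟨(eT b).some ≪≫ eqToIso h.symm ≪≫ (eT a).some.symm⟩

/-- A periodic object is a direct summand of an invariant one. -/
lemma exists_invariant_of_periodic (F : C ≌ C) [F.functor.Additive] (S : C) {n : ℕ}
    (hn : 0 < n) (h : Nonempty ((funcPow F.functor n).obj S ≅ S)) :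
    ∃ (T : C) (s : S ⟶ T) (r : T ⟶ S), s ≫ r = 𝟙 S ∧ Nonempty (F.functor.obj T ≅ T) := by
  obtain ⟨m, rfl⟩ := Nat.exists_eq_succ_of_ne_zero hn.ne'
  obtain ⟨e⟩ := h
  let f : Fin (m + 1) → C := fun i => (funcPow F.functor i).obj S
  have w (i : Fin (m + 1)) : Nonempty (f (finRotate (m + 1) i) ≅ F.functor.obj (f i)) := by
    induction i using Fin.lastCases with
    | last => rw [finRotate_last]; exact ⟨e.symm⟩
    | cast i =>
      rw [finRotate_of_lt (by simp)]
      exact ⟨Iso.refl _⟩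
  refine ⟨⨁ f, biproduct.ι f 0, biproduct.π f 0, biproduct.ι_π_self f 0, ⟨?_⟩⟩
  exact F.functor.mapBiproduct f ≪≫
    biproduct.whiskerEquiv (finRotate (m + 1)) fun i => (w i).some

end FiniteLength

section ExtensionClasses

attribute [local instance] Abelian.hasFiniteBiproducts

variable [HasExt.{w} C]

/-- A class in `Ext¹` is a Yoneda class if it is the class of a short exact sequence. -/
def IsYonedaClass {X Y : C} (e : Ext Y X 1) : Prop :=
  ∃ (J : C) (i : X ⟶ J) (p : J ⟶ Y) (w : i ≫ p = 0)
    (h : (ShortComplex.mk i p w).ShortExact), h.extClass = e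

lemma IsYonedaClass.comp_mk₀ {X X' Y : C} {e : Ext Y X 1} (he : IsYonedaClass e) (f : X ⟶ X') :
    IsYonedaClass (e.comp (Ext.mk₀ f) (add_zero 1)) := by
  obtain ⟨J, i, p, w, h, rfl⟩ := he
  have := h.mono_f
  have := h.epi_g
  dsimp at *
  have w' : pushout.inr i f ≫ pushout.desc p 0 (by simp [w]) = 0 :=
    pushout.inr_desc _ _ _
  have hp : pushout.inl i f ≫ pushout.desc p (0 : X' ⟶ Y) (by simp [w]) = p :=
    pushout.inl_desc _ _ _
  have h' : (ShortComplex.mk _ _ w').ShortExact :=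
    { exact := by
        refine ShortComplex.exact_of_g_is_cokernel _ (CokernelCofork.IsColimit.ofπ _ _
          (fun k hk => h.exact.desc (pushout.inl i f ≫ k) ?_) ?_ ?_)
        · dsimp
          rw [pushout.condition_assoc, hk, comp_zero]
        · intro Z k hk
          apply pushout.hom_ext
          · rw [← Category.assoc, hp]
            exact h.exact.g_desc _ _
          · rw [← Category.assoc, w', zero_comp]
            exact hk.symm
        · intro Z k hk m hm
          rw [← cancel_epi p]
          refine Eq.trans ?_ (h.exact.g_desc _ _).symm
          rw [← hm, ← Category.assoc, hp]
      mono_f := by dsimp; infer_instance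
      epi_g := epi_of_epi_fac hp }
  refine ⟨_, _, _, w', h', ?_⟩
  let φ : ShortComplex.mk i p w ⟶ ShortComplex.mk _ _ w' :=
    { τ₁ := f
      τ₂ := pushout.inl i f
      τ₃ := 𝟙 Y
      comm₁₂ := pushout.condition.symm
      comm₂₃ := by dsimp; rw [hp, Category.comp_id] }
  have := ShortComplex.ShortExact.extClass_naturality h h' φ
  dsimp [φ] at this
  rw [this, Ext.mk₀_id_comp]

lemma IsYonedaClass.mk₀_comp {X Y Y' : C} {e : Ext Y X 1} (he : IsYonedaClass e) (g : Y' ⟶ Y) :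
    IsYonedaClass ((Ext.mk₀ g).comp e (zero_add 1)) := by
  obtain ⟨J, i, p, w, h, rfl⟩ := he
  have := h.mono_f
  have := h.epi_g
  dsimp at *
  have w' : pullback.lift i 0 (by simp [w]) ≫ pullback.snd p g = 0 :=
    pullback.lift_snd _ _ _
  have hi : pullback.lift i (0 : X ⟶ Y') (by simp [w]) ≫ pullback.fst p g = i :=
    pullback.lift_fst _ _ _
  have h' : (ShortComplex.mk _ _ w').ShortExact :=
    { exact := by
        refine ShortComplex.exact_of_f_is_kernel _ (KernelFork.IsLimit.ofι _ _
          (fun k hk => h.exact.lift (k ≫ pullback.fst p g) ?_) ?_ ?_)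
        · dsimp
          rw [Category.assoc, pullback.condition, ← Category.assoc, hk, zero_comp]
        · intro Z k hk
          apply pullback.hom_ext
          · rw [Category.assoc, hi]
            exact h.exact.lift_f _ _
          · rw [Category.assoc, w', comp_zero]
            exact hk.symm
        · intro Z k hk m hm
          rw [← cancel_mono i]
          refine Eq.trans ?_ (h.exact.lift_f _ _).symm
          rw [← hm, Category.assoc, hi]
      mono_f := mono_of_mono_fac hi
      epi_g := by dsimp; infer_instance }
  refine ⟨_, _, _, w', h', ?_⟩
  let φ : ShortComplex.mk _ _ w' ⟶ ShortComplex.mk i p w :=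
    { τ₁ := 𝟙 X
      τ₂ := pullback.fst p g
      τ₃ := g
      comm₁₂ := by dsimp; rw [hi, Category.id_comp]
      comm₂₃ := pullback.condition }
  have := ShortComplex.ShortExact.extClass_naturality h' h φ
  dsimp [φ] at this
  rw [← this, Ext.comp_mk₀_id]

/-- A finite family of Yoneda classes is the family of components of a single Yoneda class. -/
lemma exists_isYonedaClass_biproduct {X : C} {d : ℕ} {Y : Fin d → C} (e : ∀ a, Ext (Y a) X 1)
    (he : ∀ a, IsYonedaClass (e a)) :
    ∃ E : Ext (⨁ Y) X 1, IsYonedaClass E ∧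
      ∀ a, (Ext.mk₀ (biproduct.ι Y a)).comp E (zero_add 1) = e a := by
  choose J i p w h he using he
  have := fun a => (h a).mono_f
  have := fun a => (h a).epi_g
  dsimp at *
  have w' : biproduct.map i ≫ biproduct.map p = 0 := by
    ext a b
    simp [w]
  have h' : (ShortComplex.mk _ _ w').ShortExact :=
    { exact := by
        refine ShortComplex.exact_of_f_is_kernel _ (KernelFork.IsLimit.ofι _ _
          (fun k hk => biproduct.lift fun a => (h a).exact.lift (k ≫ biproduct.π J a) ?_) ?_ ?_)
        · dsimp at hk ⊢
          rw [Category.assoc, ← biproduct.map_π, ← Category.assoc, hk, zero_comp]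
        · intro Z k hk
          apply biproduct.hom_ext
          intro a
          rw [Category.assoc, biproduct.map_π, biproduct.lift_π_assoc]
          exact (h a).exact.lift_f _ _
        · intro Z k hk m hm
          apply biproduct.hom_ext
          intro a
          rw [biproduct.lift_π, ← cancel_mono (i a)]
          refine Eq.trans ?_ ((h a).exact.lift_f _ _).symm
          rw [← hm, Category.assoc, Category.assoc, biproduct.map_π]
      mono_f := by dsimp; infer_instance
      epi_g := by dsimp; infer_instance }
  refine ⟨h'.extClass.comp (Ext.mk₀ (biproduct.desc fun _ => 𝟙 X)) (add_zero 1),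
    IsYonedaClass.comp_mk₀ ⟨_, _, _, w', h', rfl⟩ _, fun a => ?_⟩
  let φ : ShortComplex.mk (i a) (p a) (w a) ⟶ ShortComplex.mk _ _ w' :=
    { τ₁ := biproduct.ι (fun _ => X) a
      τ₂ := biproduct.ι _ a
      τ₃ := biproduct.ι _ a
      comm₁₂ := biproduct.ι_map _ _
      comm₂₃ := biproduct.ι_map _ _ }
  have := ShortComplex.ShortExact.extClass_naturality (h a) h' φ
  dsimp [φ] at this
  rw [← Ext.comp_assoc_of_third_deg_zero, ← this, Ext.comp_assoc_of_third_deg_zero,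
    Ext.mk₀_comp_mk₀, biproduct.ι_desc, Ext.comp_mk₀_id, he]

/-- A morphism out of the left term of a short exact sequence extends to the middle term if it
kills the extension class. -/
lemma exists_extension_of_extClass_comp_eq_zero {S : ShortComplex C} (h : S.ShortExact) {Y : C}
    (f : S.X₁ ⟶ Y) (hf : h.extClass.comp (Ext.mk₀ f) (add_zero 1) = 0) :
    ∃ g : S.X₂ ⟶ Y, S.f ≫ g = f := by
  obtain ⟨x, hx⟩ := Ext.contravariant_sequence_exact₁ h Y (Ext.mk₀ f) (add_zero 1) hf
  obtain ⟨g, rfl⟩ := (Ext.mk₀_bijective _ _).2 x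
  rw [Ext.mk₀_comp_mk₀] at hx
  exact ⟨g, (Ext.mk₀_bijective _ _).1 hx⟩

/-- A morphism into the right term of a short exact sequence lifts to the middle term if the
extension class pulls back to zero. -/
lemma exists_lift_of_comp_extClass_eq_zero {S : ShortComplex C} (h : S.ShortExact) {X : C}
    (f : X ⟶ S.X₃) (hf : (Ext.mk₀ f).comp h.extClass (zero_add 1) = 0) :
    ∃ g : X ⟶ S.X₂, g ≫ S.g = f := by
  obtain ⟨x, hx⟩ := Ext.covariant_sequence_exact₃ X h (Ext.mk₀ f) (zero_add 1) hf
  obtain ⟨g, rfl⟩ := (Ext.mk₀_bijective _ _).2 x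
  rw [Ext.mk₀_comp_mk₀] at hx
  exact ⟨g, (Ext.mk₀_bijective _ _).1 hx⟩

/-- Two short exact sequences whose classes agree up to isomorphisms of the outer terms have
isomorphic middle terms. -/
lemma nonempty_iso_X₂_of_extClass_comp_eq {S₁ S₂ : ShortComplex C} (h₁ : S₁.ShortExact)
    (h₂ : S₂.ShortExact) (α : S₁.X₁ ≅ S₂.X₁) (β : S₁.X₃ ≅ S₂.X₃)
    (h : h₁.extClass.comp (Ext.mk₀ α.hom) (add_zero 1) =
      (Ext.mk₀ β.hom).comp h₂.extClass (zero_add 1)) : Nonempty (S₁.X₂ ≅ S₂.X₂) := by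
  obtain ⟨g, hg⟩ := exists_extension_of_extClass_comp_eq_zero h₁ (α.hom ≫ S₂.f) (by
    rw [← Ext.mk₀_comp_mk₀, ← Ext.comp_assoc_of_third_deg_zero, h,
      Ext.comp_assoc_of_third_deg_zero, h₂.extClass_comp, Ext.comp_zero])
  have := h₁.epi_g
  let γ : S₁.X₃ ⟶ S₂.X₃ := h₁.exact.desc (g ≫ S₂.g) (by rw [reassoc_of% hg]; simp)
  have hγ : S₁.g ≫ γ = g ≫ S₂.g := h₁.exact.g_desc _ _
  let φ : S₁ ⟶ S₂ :=
    { τ₁ := α.hom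
      τ₂ := g
      τ₃ := γ
      comm₁₂ := hg.symm
      comm₂₃ := hγ.symm }
  have hφ := ShortComplex.ShortExact.extClass_naturality h₁ h₂ φ
  dsimp [φ] at hφ
  obtain ⟨l, hl⟩ := exists_lift_of_comp_extClass_eq_zero h₂ (β.hom - γ) (by
    have : Ext.mk₀ β.hom = Ext.mk₀ (β.hom - γ) + Ext.mk₀ γ := by
      rw [← Ext.mk₀_add', sub_add_cancel]
    rw [h, this, Ext.add_comp, add_eq_right] at hφ
    exact hφ)
  let ψ : S₁ ⟶ S₂ :=
    { τ₁ := α.hom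
      τ₂ := g + S₁.g ≫ l
      τ₃ := β.hom
      comm₁₂ := by simp [hg]
      comm₂₃ := by simp [hl, hγ] }
  have : IsIso ψ.τ₁ := by dsimp [ψ]; infer_instance
  have : IsIso ψ.τ₃ := by dsimp [ψ]; infer_instance
  have := ShortComplex.isIso₂_of_shortExact_of_isIso₁₃ ψ h₁ h₂
  exact ⟨asIso ψ.τ₂⟩

end ExtensionClasses

section UniversalExtension

attribute [local instance] Abelian.hasFiniteBiproducts

variable {k : Type t} [Field k] [Linear k C]

/-- The endomorphism of a power of `T` given by a matrix of scalars. -/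
noncomputable def scalarMatrixHom (T : C) {d : ℕ} (A : Matrix (Fin d) (Fin d) k) :
    (⨁ fun _ : Fin d => T) ⟶ ⨁ fun _ : Fin d => T :=
  biproduct.matrix fun a b => A a b • 𝟙 T

lemma scalarMatrixHom_mul (T : C) {d : ℕ} (A B : Matrix (Fin d) (Fin d) k) :
    scalarMatrixHom T A ≫ scalarMatrixHom T B = scalarMatrixHom T (A * B) := by
  ext a b
  simp [scalarMatrixHom, biproduct.lift_desc, Matrix.mul_apply, Finset.sum_smul, smul_smul,
    mul_comm]

lemma scalarMatrixHom_one (T : C) (d : ℕ) :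
    scalarMatrixHom T (1 : Matrix (Fin d) (Fin d) k) = 𝟙 _ := by
  ext b a
  rw [scalarMatrixHom, biproduct.matrix_π, biproduct.ι_desc, Category.id_comp]
  by_cases h : a = b
  · subst h
    rw [Matrix.one_apply_eq, one_smul, biproduct.ι_π_self]
  · rw [Matrix.one_apply_ne h, zero_smul, biproduct.ι_π_ne _ h]

variable [HasExt.{w} C]

lemma mk₀_smul_id_comp {X Y : C} (c : k) (e : Ext Y X 1) :
    (Ext.mk₀ (c • 𝟙 Y)).comp e (zero_add 1) = c • e := by
  rw [Ext.smul_def, ← Ext.smul_eq_comp_mk₀, Ext.mk₀_smul, Ext.smul_comp, Ext.mk₀_id_comp]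

lemma mk₀_lift_smul_id_comp {X T : C} {d : ℕ} (E : Ext (⨁ fun _ : Fin d => T) X 1)
    (c : Fin d → k) :
    (Ext.mk₀ (biproduct.lift fun a => c a • 𝟙 T)).comp E (zero_add 1) =
      ∑ a, c a • (Ext.mk₀ (biproduct.ι (fun _ : Fin d => T) a)).comp E (zero_add 1) := by
  have : (biproduct.lift fun a : Fin d => c a • 𝟙 T) =
      ∑ a, (c a • 𝟙 T) ≫ biproduct.ι (fun _ : Fin d => T) a := biproduct.lift_eq
  rw [this, Ext.mk₀_sum, Ext.sum_comp]
  refine Finset.sum_congr rfl fun a _ => ?_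
  rw [← Ext.mk₀_comp_mk₀, Ext.comp_assoc_of_second_deg_zero, mk₀_smul_id_comp]

lemma ext_biproduct_ext {X T : C} {d : ℕ} {E E' : Ext (⨁ fun _ : Fin d => T) X 1}
    (h : ∀ a, (Ext.mk₀ (biproduct.ι (fun _ : Fin d => T) a)).comp E (zero_add 1) =
      (Ext.mk₀ (biproduct.ι (fun _ : Fin d => T) a)).comp E' (zero_add 1)) : E = E' :=
  (Ext.biproductAddEquiv (biproduct.isBilimit fun _ : Fin d => T) X 1).injective (funext h)

/-- Let two extensions of `T ^ d` by `I` be given, such that the components of the class of the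
first one are combinations of those of the second one, and such that the first one splits over no
nonzero scalar morphism `T ⟶ T ^ d`. Then the middle terms are isomorphic. -/
lemma nonempty_iso_of_components_mem_span {I T : C} {d : ℕ} {J J' : C} {i : I ⟶ J} {i' : I ⟶ J'}
    {p : J ⟶ ⨁ fun _ : Fin d => T} {p' : J' ⟶ ⨁ fun _ : Fin d => T} {w : i ≫ p = 0}
    {w' : i' ≫ p' = 0} (h : (ShortComplex.mk i p w).ShortExact)
    (h' : (ShortComplex.mk i' p' w').ShortExact) (A : Matrix (Fin d) (Fin d) k)
    (hA : ∀ a, (Ext.mk₀ (biproduct.ι (fun _ : Fin d => T) a)).comp h.extClass (zero_add 1) =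
      ∑ b, A a b • (Ext.mk₀ (biproduct.ι (fun _ : Fin d => T) b)).comp h'.extClass (zero_add 1))
    (hlift : ∀ (c : Fin d → k) (s : T ⟶ J), (s ≫ p = biproduct.lift fun a => c a • 𝟙 T) → c = 0) :
    Nonempty (J ≅ J') := by
  have hrows : LinearIndependent k A.row := by
    rw [Fintype.linearIndependent_iff]
    intro c hc
    obtain ⟨s, hs⟩ := exists_lift_of_comp_extClass_eq_zero h
      (biproduct.lift fun a => c a • 𝟙 T) (by
        rw [mk₀_lift_smul_id_comp]
        simp only [hA, Finset.smul_sum, smul_smul]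
        rw [Finset.sum_comm]
        refine Finset.sum_eq_zero fun a _ => ?_
        have := congrFun hc a
        simp only [Finset.sum_apply, Pi.smul_apply, smul_eq_mul, Pi.zero_apply,
          Matrix.row_apply] at this
        rw [← Finset.sum_smul, this, zero_smul])
    exact congrFun (hlift c s hs)
  have hdet : IsUnit A.det :=
    (Matrix.isUnit_iff_isUnit_det A).1 (Matrix.linearIndependent_rows_iff_isUnit.1 hrows)
  let γ : (⨁ fun _ : Fin d => T) ≅ ⨁ fun _ : Fin d => T :=
    { hom := scalarMatrixHom T A
      inv := scalarMatrixHom T A⁻¹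
      hom_inv_id := by
        rw [scalarMatrixHom_mul, Matrix.mul_nonsing_inv _ hdet, scalarMatrixHom_one]
      inv_hom_id := by
        rw [scalarMatrixHom_mul, Matrix.nonsing_inv_mul _ hdet, scalarMatrixHom_one] }
  refine nonempty_iso_X₂_of_extClass_comp_eq h h' (Iso.refl I) γ ?_
  refine (Ext.comp_mk₀_id _).trans (ext_biproduct_ext fun a => ?_)
  rw [hA, ← mk₀_lift_smul_id_comp]
  change _ = (Ext.mk₀ _).comp ((Ext.mk₀ (scalarMatrixHom T A)).comp _ _) _
  rw [Ext.mk₀_comp_mk₀_assoc, scalarMatrixHom, biproduct.ι_matrix]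

/-- The universal extension of an invariant object `I` by powers of an invariant object `T` is
invariant. -/
lemma exists_invariant_killing_yonedaClasses (F : C ≌ C) [F.functor.Additive]
    [F.functor.Linear k] (I T : C) (eI : F.functor.obj I ≅ I) (eT : F.functor.obj T ≅ T)
    (hfin : FiniteDimensional k (Ext T I 1)) :
    ∃ (J : C) (i : I ⟶ J), Mono i ∧ Nonempty (F.functor.obj J ≅ J) ∧
      ∀ e : Ext T I 1, IsYonedaClass e → e.comp (Ext.mk₀ i) (add_zero 1) = 0 := by
  obtain ⟨b, hbs, hspan, hli⟩ := exists_linearIndependent k {e : Ext T I 1 | IsYonedaClass e}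
  let hb := hli.setFinite.fintype
  let d := Fintype.card b
  let v : Fin d → Ext T I 1 := fun a => ((Fintype.equivFin b).symm a : Ext T I 1)
  have hv : LinearIndependent k v := hli.comp _ (Fintype.equivFin b).symm.injective
  have hvr : Set.range v = b := by
    rw [show v = Subtype.val ∘ (Fintype.equivFin b).symm from rfl,
      (Fintype.equivFin b).symm.surjective.range_comp, Subtype.range_val]
  have hvs (e : Ext T I 1) (he : IsYonedaClass e) : ∃ c : Fin d → k, ∑ a, c a • v a = e := by
    rw [← Submodule.mem_span_range_iff_exists_fun, hvr, hspan]
    exact Submodule.subset_span he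
  obtain ⟨E, ⟨J, i, p, w, h, rfl⟩, hEv⟩ := exists_isYonedaClass_biproduct (Y := fun _ => T) v
    fun a => hbs ((Fintype.equivFin b).symm a).2
  have hlift (c : Fin d → k) : (Ext.mk₀ (biproduct.lift fun a => c a • 𝟙 T)).comp h.extClass
      (zero_add 1) = ∑ a, c a • v a := by
    rw [mk₀_lift_smul_id_comp]
    simp only [hEv]
  refine ⟨J, i, h.mono_f, ?_, fun e he => ?_⟩
  swap
  · obtain ⟨c, rfl⟩ := hvs e he
    rw [← hlift, Ext.comp_assoc_of_third_deg_zero]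
    exact (congrArg (Ext.comp _ · _) h.extClass_comp).trans (Ext.comp_zero _ _ _ _ _)
  let β : F.functor.obj (⨁ fun _ : Fin d => T) ≅ ⨁ fun _ : Fin d => T :=
    F.functor.mapBiproduct _ ≪≫ biproduct.mapIso fun _ => eT
  have hβ (c : Fin d → k) : F.functor.map (biproduct.lift fun a => c a • 𝟙 T) ≫ β.hom =
      eT.hom ≫ biproduct.lift fun a => c a • 𝟙 T := by
    apply biproduct.hom_ext
    intro a
    rw [Iso.trans_hom, ← Category.assoc, biproduct.map_lift_mapBiprod]
    simp [Functor.map_smul]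
  have w' : (eI.inv ≫ F.functor.map i) ≫ F.functor.map p ≫ β.hom = 0 := by
    rw [Category.assoc, ← Functor.map_comp_assoc, w]
    simp
  let φ : (ShortComplex.mk i p w).map F.functor ≅ ShortComplex.mk _ _ w' :=
    ShortComplex.isoMk eI (Iso.refl _) β
      ((eI.hom_inv_id_assoc _).trans (Category.comp_id _).symm) (Category.id_comp _)
  have h' := ShortComplex.shortExact_of_iso φ (h.map_of_exact F.functor)
  choose A hA using fun a : Fin d =>
    hvs _ (IsYonedaClass.mk₀_comp ⟨_, _, _, _, h', rfl⟩ (biproduct.ι (fun _ => T) a))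
  refine nonempty_iso_of_components_mem_span h' h (Matrix.of A) (fun a => ?_) fun c s hs => ?_
  · rw [← hA a]
    simp only [hEv, Matrix.of_apply]
  · obtain ⟨r, hr⟩ := F.functor.map_surjective (eT.hom ≫ s)
    have hrp : r ≫ p = biproduct.lift fun a => c a • 𝟙 T := by
      apply F.functor.map_injective
      rw [← cancel_mono β.hom, hβ, Functor.map_comp, hr, Category.assoc, Category.assoc, hs]
    refine funext (Fintype.linearIndependent_iff.1 hv c ?_)
    rw [← hlift, ← hrp, ← Ext.mk₀_comp_mk₀, Ext.comp_assoc_of_second_deg_zero]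
    exact (congrArg (Ext.comp _ · _) h.comp_extClass).trans (Ext.comp_zero _ _ _ _ _)

/-- If a subobject with simple, periodic quotient embeds into an invariant object, then so does
the whole object. -/
lemma exists_invariant_of_simple_quotient (F : C ≌ C) [F.functor.Additive] [F.functor.Linear k]
    (hext : ∀ X Y : C, FiniteDimensional k (Ext Y X 1)) {X Y : C} (f : X ⟶ Y) [Mono f] {n : ℕ}
    (hn : 0 < n) (hF : Nonempty ((funcPow F.functor n).obj (cokernel f) ≅ cokernel f))
    (hX : ∃ (N : C) (ι : X ⟶ N), Nonempty (F.functor.obj N ≅ N) ∧ Mono ι) :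
    ∃ (N : C) (ι : Y ⟶ N), Nonempty (F.functor.obj N ≅ N) ∧ Mono ι := by
  obtain ⟨I, ι, ⟨eI⟩, _⟩ := hX
  obtain ⟨T, s, r, hsr, ⟨eT⟩⟩ := exists_invariant_of_periodic F _ hn hF
  obtain ⟨J, i, _, ⟨eJ⟩, hJ⟩ := exists_invariant_killing_yonedaClasses F I T eI eT (hext I T)
  have h : (ShortComplex.mk f (cokernel.π f) (cokernel.condition f)).ShortExact :=
    { exact := ShortComplex.exact_of_g_is_cokernel _ (cokernelIsCokernel f) }
  obtain ⟨g, hg⟩ : ∃ g : Y ⟶ J, f ≫ g = ι ≫ i := by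
    refine exists_extension_of_extClass_comp_eq_zero h (ι ≫ i) ?_
    have hr := hJ _ ((IsYonedaClass.comp_mk₀ ⟨_, _, _, _, h, rfl⟩ ι).mk₀_comp r)
    have hs := congrArg (fun e => (Ext.mk₀ s).comp e (zero_add 1)) hr
    simp only [Ext.comp_assoc_of_third_deg_zero, Ext.mk₀_comp_mk₀, Ext.mk₀_comp_mk₀_assoc, hsr,
      Ext.mk₀_id_comp, Ext.comp_zero] at hs
    exact hs
  have := preservesBinaryBiproduct_of_preservesBiproduct F.functor J T
  refine ⟨J ⊞ T, biprod.lift g (cokernel.π f ≫ s),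
    ⟨F.functor.mapBiprod J T ≪≫ biprod.mapIso eJ eT⟩, Preadditive.mono_of_cancel_zero _ ?_⟩
  intro Z z hz
  have hzg : z ≫ g = 0 := by simpa using hz =≫ biprod.fst
  have hzs : z ≫ cokernel.π f = 0 := by
    have : z ≫ cokernel.π f ≫ s = 0 := by simpa using hz =≫ biprod.snd
    rw [← Category.comp_id (cokernel.π f), ← hsr, reassoc_of% this, zero_comp]
  obtain ⟨y, rfl⟩ : ∃ y : Z ⟶ X, y ≫ f = z := ⟨h.exact.lift z hzs, h.exact.lift_f _ _⟩
  have hy : y ≫ ι ≫ i = 0 := by rw [← hg, ← Category.assoc, hzg]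
  rw [← Category.assoc] at hy
  rw [zero_of_comp_mono ι (zero_of_comp_mono i hy), zero_comp]

end UniversalExtension

/-- In a `k`-linear abelian category in which every object has finite length and all
`Ext¹`-groups are finite-dimensional, an object `M` is, for a `k`-linear self-equivalence `F`,
"F-able" (all its simple subquotients are fixed by some positive power of `F` up to
isomorphism) if and only if `M` embeds into an `F`-invariant object. -/
theorem fAble_iff_embeds_into_invariant
    {k : Type t} [Field k] [Linear k C] [HasExt.{w} C]
    (hlen : ∀ M : C, HasFiniteLength M)
    (hext : ∀ X Y : C, FiniteDimensional k (Abelian.Ext Y X 1))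
    (F : C ≌ C) [F.functor.Additive] [F.functor.Linear k] (M : C) :
    (∀ S : C, Simple S → IsSubquotient S M →
        ∃ n : ℕ, 0 < n ∧ Nonempty ((funcPow F.functor n).obj S ≅ S)) ↔
      ∃ (N : C) (ι : M ⟶ N), Nonempty (F.functor.obj N ≅ N) ∧ Mono ι := by
  constructor
  · refine (hlen M).induction (fun X hX _ => ?_) (fun e h hM => ?_) (fun f _ hS h hM => ?_)
    · exact ⟨X, 𝟙 X, ⟨(F.functor.map_isZero hX).iso hX⟩, inferInstance⟩
    · obtain ⟨N, ι, eN, _⟩ := h fun S hS hSX => hM S hS (hSX.of_mono e.hom)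
      exact ⟨N, e.inv ≫ ι, eN, mono_comp _ _⟩
    · obtain ⟨n, hn, hF⟩ := hM _ hS (isSubquotient_cokernel f)
      exact exists_invariant_of_simple_quotient F hext f hn hF
        (h fun S hS hSX => hM S hS (hSX.of_mono f))
  · rintro ⟨N, ι, ⟨e⟩, _⟩ S hS hSM
    exact exists_funcPow_iso_of_isSubquotient_invariant F (hlen N) e S hS (hSM.of_mono ι)
end

section
/- Let C be an abelian category. Let 0 → A →ᵃ E →ᵇ B → 0 be a short exact sequence in C, let ι : A ↪ A' be a monomorphism, and suppose B is a direct summand of an object B' (i.e. there are morphisms s : B → B' and r : B' → B with r ∘ s = id_B). If σ : 0 → A' →ᵘ U →ᵠ D → 0 is a short exact sequence that is universal for extensions of B' by A', then there exists a monomorphism E ↪ U ⊕ B'. -/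
open CategoryTheory Limits

universe v u

variable {C : Type u} [Category.{v} C] [Abelian C]

/-- `0 ⟶ A ⟶ E ⟶ B ⟶ 0` is a short exact sequence: `f` is a monomorphism, `g` is an
epimorphism, and `f` is a kernel of `g`. -/
def IsShortExactSeq {A E B : C} (f : A ⟶ E) (g : E ⟶ B) : Prop :=
  Mono f ∧ Epi g ∧ ∃ w : f ≫ g = 0, Nonempty (IsLimit (KernelFork.ofι f w))

/-- A short exact sequence `0 ⟶ A ⟶ U ⟶ D ⟶ 0` is universal for extensions of `B` by `A`
if every short exact sequence `0 ⟶ A ⟶ X ⟶ B ⟶ 0` either splits or maps to it via a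
morphism `ψ : X ⟶ U` lying over a monomorphism `φ : B ⟶ D`. -/
def IsUniversalExtension {A U D : C} (B : C) (u : A ⟶ U) (q : U ⟶ D) : Prop :=
  ∀ ⦃X : C⦄ (x : A ⟶ X) (y : X ⟶ B), IsShortExactSeq x y →
    (∃ ρ : X ⟶ A, x ≫ ρ = 𝟙 A) ∨
      ∃ (ψ : X ⟶ U) (φ : B ⟶ D), Mono φ ∧ x ≫ ψ = u ∧ ψ ≫ q = y ≫ φ

namespace IsShortExactSeq

variable {A E B : C} {f : A ⟶ E} {g : E ⟶ B}

lemma zero (h : IsShortExactSeq f g) : f ≫ g = 0 :=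
  h.2.2.choose

lemma exists_lift (h : IsShortExactSeq f g) {T : C} (k : T ⟶ E) (hk : k ≫ g = 0) :
    ∃ l : T ⟶ A, l ≫ f = k := by
  obtain ⟨-, -, w, ⟨hf⟩⟩ := h
  obtain ⟨l, hl⟩ := KernelFork.IsLimit.lift' hf k hk
  exact ⟨l, hl⟩

lemma exists_desc (h : IsShortExactSeq f g) {T : C} (k : E ⟶ T) (hk : f ≫ k = 0) :
    ∃ l : B ⟶ T, g ≫ l = k := by
  obtain ⟨-, _, w, ⟨hf⟩⟩ := h
  obtain ⟨l, hl⟩ := CokernelCofork.IsColimit.desc' (Abelian.epiIsCokernelOfKernel _ hf) k hk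
  exact ⟨l, hl⟩

lemma of_exists_lift [Mono f] [Epi g] (w : f ≫ g = 0)
    (hl : ∀ ⦃T : C⦄ (k : T ⟶ E), k ≫ g = 0 → ∃ l : T ⟶ A, l ≫ f = k) :
    IsShortExactSeq f g :=
  ⟨inferInstance, inferInstance, w,
    ⟨KernelFork.IsLimit.ofι' f w fun k hk => ⟨(hl k hk).choose, (hl k hk).choose_spec⟩⟩⟩

lemma of_exists_desc [Mono f] [Epi g] (w : f ≫ g = 0)
    (hd : ∀ ⦃T : C⦄ (k : E ⟶ T), f ≫ k = 0 → ∃ l : B ⟶ T, g ≫ l = k) :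
    IsShortExactSeq f g :=
  ⟨inferInstance, inferInstance, w,
    ⟨Abelian.monoIsKernelOfCokernel _ (CokernelCofork.IsColimit.ofπ' g w
      fun k hk => ⟨(hd k hk).choose, (hd k hk).choose_spec⟩)⟩⟩

/-- The pushout of an extension of `B` by `A` along a morphism `A ⟶ A'`. -/
lemma pushout_along (h : IsShortExactSeq f g) {A' : C} (i : A ⟶ A') :
    IsShortExactSeq (pushout.inr f i) (pushout.desc g 0 (by simp [h.zero])) := by
  have : Mono f := h.1
  have : Epi g := h.2.1
  have : Epi (pushout.desc (f := f) (g := i) g 0 (by simp [h.zero])) :=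
    epi_of_epi_fac (pushout.inl_desc g 0 (by simp [h.zero]))
  refine of_exists_desc (pushout.inr_desc ..) fun T k hk => ?_
  obtain ⟨l, hl⟩ := h.exists_desc (pushout.inl f i ≫ k) (by
    rw [pushout.condition_assoc, hk, comp_zero])
  exact ⟨l, by ext <;> simp [pushout.inl_desc_assoc, pushout.inr_desc_assoc, hl, hk]⟩

/-- The pullback of an extension of `B` by `A` along a morphism `B' ⟶ B`. -/
lemma pullback_along (h : IsShortExactSeq f g) {B' : C} (r : B' ⟶ B) :
    IsShortExactSeq (pullback.lift f 0 (by simp [h.zero])) (pullback.snd g r) := by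
  have : Mono f := h.1
  have : Epi g := h.2.1
  have : Mono (pullback.lift (f := g) (g := r) f 0 (by simp [h.zero])) :=
    mono_of_mono_fac (pullback.lift_fst f 0 (by simp [h.zero]))
  refine of_exists_lift (pullback.lift_snd ..) fun T k hk => ?_
  obtain ⟨l, hl⟩ := h.exists_lift (k ≫ pullback.fst g r) (by
    rw [Category.assoc, pullback.condition, reassoc_of% hk, zero_comp])
  exact ⟨l, by ext <;> simp [pullback.lift_fst, pullback.lift_snd, hl, hk]⟩

/-- A morphism out of the middle term of an extension which is monic on the subobject, paired with
a monomorphism out of the quotient, is monic. -/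
lemma mono_biprod_lift (h : IsShortExactSeq f g) {U V : C} (k : E ⟶ U) (s : B ⟶ V)
    [Mono (f ≫ k)] [Mono s] : Mono (biprod.lift k (g ≫ s)) := by
  refine Preadditive.mono_of_cancel_zero _ fun t ht => ?_
  have hk : t ≫ k = 0 := by simpa using ht =≫ biprod.fst
  have hg : (t ≫ g) ≫ s = 0 := by simpa using ht =≫ biprod.snd
  obtain ⟨l, rfl⟩ := h.exists_lift t (zero_of_comp_mono s hg)
  rw [Category.assoc] at hk
  rw [zero_of_comp_mono (f ≫ k) hk, zero_comp]

end IsShortExactSeq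

/-- Every extension of `B` by `A` maps, compatibly with the inclusions, to a universal one. -/
lemma IsUniversalExtension.exists_hom {A U D B : C} {u : A ⟶ U} {q : U ⟶ D}
    (h : IsUniversalExtension B u q) {X : C} {x : A ⟶ X} {y : X ⟶ B}
    (hxy : IsShortExactSeq x y) : ∃ ψ : X ⟶ U, x ≫ ψ = u := by
  obtain ⟨ρ, hρ⟩ | ⟨ψ, _, -, hψ, -⟩ := h x y hxy
  · exact ⟨ρ ≫ u, by rw [reassoc_of% hρ]⟩
  · exact ⟨ψ, hψ⟩

/-- Given a short exact sequence `0 ⟶ A ⟶ E ⟶ B ⟶ 0`, a monomorphism `A ↪ A'` and a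
direct summand presentation of `B` in `B'`, the middle object `E` embeds into `U ⊞ B'`
for any universal extension `0 ⟶ A' ⟶ U ⟶ D ⟶ 0` for extensions of `B'` by `A'`. -/
theorem mono_into_universalExtension_biprod {A E B A' B' U D : C}
    (a : A ⟶ E) (b : E ⟶ B) (hab : IsShortExactSeq a b)
    (ι : A ⟶ A') (hι : Mono ι)
    (s : B ⟶ B') (r : B' ⟶ B) (hsr : s ≫ r = 𝟙 B)
    (u : A' ⟶ U) (q : U ⟶ D) (hσ : IsShortExactSeq u q)
    (huniv : IsUniversalExtension B' u q) :
    ∃ m : E ⟶ U ⊞ B', Mono m := by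
  have : Mono u := hσ.1
  have : Mono s := mono_of_mono_fac hsr
  obtain ⟨ψ, hψ⟩ := huniv.exists_hom ((hab.pushout_along ι).pullback_along r)
  let e : E ⟶ pullback (pushout.desc b 0 (by simp [hab.zero]) : pushout a ι ⟶ B) r :=
    pullback.lift (pushout.inl a ι) (b ≫ s) (by simp [pushout.inl_desc, hsr])
  have he : a ≫ e = ι ≫ pullback.lift (pushout.inr a ι) 0 (by simp [pushout.inr_desc]) := by
    ext
    · simp [e, pullback.lift_fst, pushout.condition]
    · simp [e, pullback.lift_snd, reassoc_of% hab.zero]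
  have : Mono (a ≫ e ≫ ψ) := by
    rw [reassoc_of% he, hψ]
    infer_instance
  exact ⟨_, hab.mono_biprod_lift (e ≫ ψ) s⟩
end

section
/- Let k be a field and let C be a k-linear abelian category having Ext groups. Let A, B be objects of C such that Ext¹_C(B, A) is a finite-dimensional k-vector space, of dimension n. Then there exists a short exact sequence 0 → A → U → B^{⊕n} → 0 in C which is universal for extensions of B by A, where B^{⊕n} denotes the n-fold biproduct of copies of B. -/
open CategoryTheory Limits CategoryTheory.Abelian

attribute [local instance] CategoryTheory.Abelian.hasFiniteBiproducts

universe w v u t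

variable {C : Type u} [Category.{v} C] [Abelian C]

namespace CategoryTheory.Abelian.Ext

lemma mk₀_smul_comp {k : Type t} [Field k] {C : Type u} [Category.{v} C] [Abelian C]
    [Linear k C] [HasExt.{w} C] {X Y Z : C} {n : ℕ} (c : k) (f : X ⟶ Y) (ε : Ext Y Z n) :
    (mk₀ (c • f)).comp ε (zero_add n) = c • (mk₀ f).comp ε (zero_add n) := by
  rw [smul_def, ← smul_eq_comp_mk₀, ← smul_comp, mk₀_smul]

end CategoryTheory.Abelian.Ext

lemma isShortExactSeq_iff_shortExact {A E B : C} (f : A ⟶ E) (g : E ⟶ B) (w : f ≫ g = 0) :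
    IsShortExactSeq f g ↔ (ShortComplex.mk f g w).ShortExact := by
  constructor
  · rintro ⟨hf, hg, _, ⟨h⟩⟩
    exact { exact := ShortComplex.exact_of_f_is_kernel _ h, mono_f := hf, epi_g := hg }
  · intro h
    exact ⟨h.mono_f, h.epi_g, w, ⟨h.fIsKernel⟩⟩

namespace CategoryTheory.ShortComplex.ShortExact

lemma exists_retraction_of_extClass_eq_zero [HasExt.{w} C] {S : ShortComplex C}
    (hS : S.ShortExact) (h : hS.extClass = 0) : ∃ ρ : S.X₂ ⟶ S.X₁, S.f ≫ ρ = 𝟙 S.X₁ := by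
  obtain ⟨r, hr⟩ := Ext.contravariant_sequence_exact₁ hS _ (Ext.mk₀ (𝟙 S.X₁)) (add_zero 1)
    (by rw [h, Ext.zero_comp])
  obtain ⟨ρ, rfl⟩ := (Ext.mk₀_bijective _ _).surjective r
  exact ⟨ρ, (Ext.mk₀_bijective _ _).injective (by rw [← hr, Ext.mk₀_comp_mk₀])⟩

/-- If the class of an extension `S` is the pull-back along `φ` of the class of an extension `T`
with the same kernel, then `S` maps to `T` over `φ` by a morphism inducing the identity on the
kernels. -/
lemma exists_hom_of_extClass_eq [HasExt.{w} C] {A X B U D : C} {x : A ⟶ X} {y : X ⟶ B}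
    {u : A ⟶ U} {q : U ⟶ D} {w₁ : x ≫ y = 0} {w₂ : u ≫ q = 0}
    (hS : (ShortComplex.mk x y w₁).ShortExact) (hT : (ShortComplex.mk u q w₂).ShortExact)
    (φ : B ⟶ D) (h : hS.extClass = (Ext.mk₀ φ).comp hT.extClass (zero_add 1)) :
    ∃ ψ : X ⟶ U, x ≫ ψ = u ∧ ψ ≫ q = y ≫ φ := by
  obtain ⟨p, hp⟩ := Ext.covariant_sequence_exact₃ X hT (Ext.mk₀ (y ≫ φ)) (zero_add 1) (by
    rw [← Ext.mk₀_comp_mk₀, Ext.comp_assoc_of_second_deg_zero, ← h]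
    exact hS.comp_extClass)
  obtain ⟨ψ, rfl⟩ := (Ext.mk₀_bijective _ _).surjective p
  rw [Ext.mk₀_comp_mk₀] at hp
  have hψ : ψ ≫ q = y ≫ φ := (Ext.mk₀_bijective _ _).injective hp
  have : Mono u := hT.mono_f
  obtain ⟨a, ha⟩ : ∃ a : A ⟶ A, a ≫ u = x ≫ ψ :=
    ⟨hT.exact.lift (x ≫ ψ) (by simp [hψ, reassoc_of% w₁]), hT.exact.lift_f _ _⟩
  have hnat := extClass_naturality hS hT { τ₁ := a, τ₂ := ψ, τ₃ := φ, comm₁₂ := ha, comm₂₃ := hψ }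
  dsimp only at hnat
  obtain ⟨r, hr⟩ := Ext.contravariant_sequence_exact₁ hS _ (Ext.mk₀ (a - 𝟙 A)) (add_zero 1) (by
    rw [sub_eq_add_neg, Ext.mk₀_add, Ext.comp_add, Ext.mk₀_neg, Ext.comp_neg, hnat, ← h]
    erw [Ext.comp_mk₀_id]
    exact add_neg_cancel _)
  obtain ⟨ρ, rfl⟩ := (Ext.mk₀_bijective _ _).surjective r
  rw [Ext.mk₀_comp_mk₀] at hr
  have hρ : x ≫ ρ = a - 𝟙 A := (Ext.mk₀_bijective _ _).injective hr
  refine ⟨ψ - ρ ≫ u, ?_, ?_⟩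
  · rw [Preadditive.comp_sub, ← Category.assoc, hρ, ← ha, Preadditive.sub_comp,
      Category.id_comp, sub_sub_cancel]
  · rw [Preadditive.sub_comp, Category.assoc, w₂, comp_zero, sub_zero, hψ]

lemma biproduct_map {J : Type*} [Finite J] {A X B : J → C} {x : ∀ j, A j ⟶ X j}
    {y : ∀ j, X j ⟶ B j} {z : ∀ j, x j ≫ y j = 0}
    (hS : ∀ j, (ShortComplex.mk (x j) (y j) (z j)).ShortExact) :
    (ShortComplex.mk (biproduct.map x) (biproduct.map y)
      (by ext; simp [z])).ShortExact := by
  have (j : J) : Mono (x j) := (hS j).mono_f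
  have (j : J) : Epi (y j) := (hS j).epi_g
  refine { exact := ShortComplex.exact_of_f_is_kernel _
            (KernelFork.IsLimit.ofι' _ _ fun {W} m hm ↦ ?_)
           mono_f := inferInstanceAs (Mono (biproduct.map x))
           epi_g := inferInstanceAs (Epi (biproduct.map y)) }
  have hm' (j : J) : (m ≫ biproduct.π X j) ≫ y j = 0 := by
    simpa using hm =≫ biproduct.π B j
  exact ⟨biproduct.lift fun j ↦ (hS j).exact.lift _ (hm' j), by
    ext j
    simpa using (hS j).exact.lift_f _ (hm' j)⟩

lemma pushout {A A' X B : C} {x : A ⟶ X} {y : X ⟶ B} {z : x ≫ y = 0}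
    (hS : (ShortComplex.mk x y z).ShortExact) (a : A ⟶ A') :
    (ShortComplex.mk (pushout.inr x a) (pushout.desc y 0 (by simp [z]))
      (pushout.inr_desc _ _ _)).ShortExact := by
  have : Mono x := hS.mono_f
  have : Epi y := hS.epi_g
  have : Epi (pushout.desc y 0 (by simp [z]) : Limits.pushout x a ⟶ B) :=
    epi_of_epi_fac (pushout.inl_desc _ _ _)
  refine { exact := ShortComplex.exact_of_g_is_cokernel _
            (CokernelCofork.IsColimit.ofπ' _ _ fun {W} m hm ↦ ?_)
           mono_f := inferInstanceAs (Mono (pushout.inr x a))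
           epi_g := this }
  have hm' : x ≫ pushout.inl x a ≫ m = 0 := by
    rw [pushout.condition_assoc, hm, comp_zero]
  exact ⟨hS.exact.desc (pushout.inl x a ≫ m) hm', by
    apply pushout.hom_ext
    · exact (pushout.inl_desc_assoc _ _ _ _).trans (hS.exact.g_desc _ hm')
    · exact (pushout.inr_desc_assoc _ _ _ _).trans (zero_comp.trans hm.symm)⟩

end CategoryTheory.ShortComplex.ShortExact

/-- The classes in `Ext B A 1` of short exact sequences `0 ⟶ A ⟶ X ⟶ B ⟶ 0`. -/
def extensionClasses [HasExt.{w} C] (A B : C) : Set (Abelian.Ext B A 1) :=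
  {ε | ∃ (X : C) (x : A ⟶ X) (y : X ⟶ B) (z : x ≫ y = 0)
    (hS : (ShortComplex.mk x y z).ShortExact), hS.extClass = ε}

lemma extensionClasses_nonempty [HasExt.{w} C] (A B : C) : (extensionClasses A B).Nonempty :=
  ⟨_, A ⊞ B, biprod.inl, biprod.snd, biprod.inl_snd,
    (ShortComplex.Splitting.ofHasBinaryBiproduct A B).shortExact, rfl⟩

/-- Finitely many extensions of objects `B j` by `A` assemble to an extension of `⨁ B` by `A`. -/
lemma exists_extension_biproduct [HasExt.{w} C] {J : Type*} [Finite J] {A : C} {B : J → C}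
    (ε : ∀ j, Abelian.Ext (B j) A 1) (hε : ∀ j, ε j ∈ extensionClasses A (B j)) :
    ∃ (U : C) (u : A ⟶ U) (q : U ⟶ ⨁ B) (z : u ≫ q = 0)
      (hT : (ShortComplex.mk u q z).ShortExact),
      ∀ j, (Ext.mk₀ (biproduct.ι B j)).comp hT.extClass (zero_add 1) = ε j := by
  choose X x y z hS hcls using hε
  let a : (⨁ fun _ : J => A) ⟶ A := biproduct.desc fun _ ↦ 𝟙 A
  have hT := (ShortComplex.ShortExact.biproduct_map hS).pushout a
  refine ⟨_, _, _, _, hT, fun j ↦ ?_⟩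
  have hnat := ShortComplex.ShortExact.extClass_naturality (hS j) hT
    { τ₁ := 𝟙 A
      τ₂ := biproduct.ι X j ≫ pushout.inl (biproduct.map x) a
      τ₃ := biproduct.ι B j
      comm₁₂ := by
        have h : x j ≫ biproduct.ι X j = biproduct.ι (fun _ : J => A) j ≫ biproduct.map x := by
          simp
        dsimp only
        rw [reassoc_of% h, pushout.condition]
        simp [a]
      comm₂₃ := by
        dsimp only
        rw [Category.assoc, pushout.inl_desc, biproduct.ι_map] }
  rw [← hcls j]
  exact hnat.symm.trans (Ext.comp_mk₀_id _)

lemma Set.Nonempty.exists_fin_finrank_subset_span {k V : Type*} [Field k] [AddCommGroup V]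
    [Module k V] [FiniteDimensional k V] {s : Set V} (hs : s.Nonempty) :
    ∃ f : Fin (Module.finrank k V) → V, (∀ i, f i ∈ s) ∧
      s ⊆ Submodule.span k (Set.range f) := by
  obtain ⟨v, hv⟩ := hs
  obtain ⟨f, hf, hspan, -⟩ := Submodule.exists_fun_fin_finrank_span_eq k s
  have hle := Submodule.finrank_le (Submodule.span k s)
  refine ⟨fun i ↦ if h : i.1 < Module.finrank k (Submodule.span k s) then f ⟨i, h⟩ else v,
    fun i ↦ ?_, ?_⟩
  · dsimp only
    split_ifs
    exacts [hf _, hv]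
  · refine Submodule.subset_span.trans (hspan.symm.le.trans (Submodule.span_mono ?_))
    rintro _ ⟨i, rfl⟩
    exact ⟨⟨i, i.2.trans_le hle⟩, by simp⟩

/-- If `Ext¹_C(B, A)` is a finite-dimensional `k`-vector space of dimension `n`, then there
exists a short exact sequence `0 ⟶ A ⟶ U ⟶ B^{⊕n} ⟶ 0` which is universal for extensions
of `B` by `A`. -/
theorem exists_universalExtension
    {k : Type t} [Field k] [Linear k C] [HasExt.{w} C] (A B : C) (n : ℕ)
    (hfd : FiniteDimensional k (Abelian.Ext B A 1))
    (hn : Module.finrank k (Abelian.Ext B A 1) = n) :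
    ∃ (U : C) (u : A ⟶ U) (q : U ⟶ ⨁ fun _ : Fin n => B),
      IsShortExactSeq u q ∧ IsUniversalExtension B u q := by
  subst hn
  obtain ⟨ε, hε, hspan⟩ := (extensionClasses_nonempty A B).exists_fin_finrank_subset_span (k := k)
  obtain ⟨U, u, q, z, hT, hcls⟩ := exists_extension_biproduct ε hε
  refine ⟨U, u, q, (isShortExactSeq_iff_shortExact u q z).2 hT, fun X x y hxy ↦ ?_⟩
  have hS := (isShortExactSeq_iff_shortExact x y hxy.2.2.1).1 hxy
  obtain ⟨c, hc⟩ := (Submodule.mem_span_range_iff_exists_fun k).1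
    (hspan ⟨X, x, y, _, hS, rfl⟩)
  by_cases h0 : hS.extClass = 0
  · exact Or.inl (hS.exists_retraction_of_extClass_eq_zero h0)
  obtain ⟨j, hj⟩ : ∃ j, c j ≠ 0 := by
    by_contra! h
    exact h0 (by rw [← hc]; simp [h])
  let φ : B ⟶ ⨁ fun _ : Fin (Module.finrank k (Abelian.Ext B A 1)) => B :=
    ∑ i, c i • biproduct.ι (fun _ => B) i
  have hφ : φ ≫ biproduct.π (fun _ => B) j ≫ ((c j)⁻¹ • 𝟙 B) = 𝟙 B := by
    simp [φ, Preadditive.sum_comp, biproduct.ι_π, hj]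
  obtain ⟨ψ, h₁, h₂⟩ := hS.exists_hom_of_extClass_eq hT φ (by
    simp only [φ, Ext.mk₀_sum, Ext.sum_comp, Ext.mk₀_smul_comp]
    rw [← hc]
    exact Finset.sum_congr rfl fun i _ ↦ by rw [← hcls i])
  exact Or.inr ⟨ψ, φ, mono_of_mono_fac hφ, h₁, h₂⟩
end
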